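/- Let σ₁, σ₂ be commuting involutions of g with quaternionic decomposition g = g₀₀ ⊕ g₀₁ ⊕ g₁₀ ⊕ g₁₁, and let (α, β, γ) be any permutation of the indices (01, 10, 11). If every Cartan subspace of g_α is also a Cartan subspace of g_α ⊕ g_γ, then dim g_β ≥ dim g_γ. -/

import Mathlib

open LieAlgebra Module

variable (k : Type*) [Field k] [IsAlgClosed k] [CharZero k]
variable (g : Type*) [LieRing g] [LieAlgebra k g] [FiniteDimensional k g]
  [LieAlgebra.IsSemisimple k g]

/-- The eigenspace of a Lie algebra automorphism `σ` for the eigenvalue `c`. -/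
noncomputable def eigSub (σ : g ≃ₗ⁅k⁆ g) (c : k) : Submodule k g :=
  Module.End.eigenspace (σ.toLinearEquiv : g →ₗ[k] g) c

/-- A Lie algebra involution: an automorphism `σ` with `σ ∘ σ = id`. -/
def IsInvolution (σ : g ≃ₗ⁅k⁆ g) : Prop := ∀ x, σ (σ x) = x

/-- Two commuting involutions. -/
def CommutingInvolutions (σ₁ σ₂ : g ≃ₗ⁅k⁆ g) : Prop :=
  IsInvolution k g σ₁ ∧ IsInvolution k g σ₂ ∧ ∀ x, σ₁ (σ₂ x) = σ₂ (σ₁ x)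

/-- The subspace `g_{ij}` of the quaternionic decomposition determined by commuting
involutions `σ₁, σ₂`: here `i, j : Bool` and `false, true` encode the exponents `0, 1`
of the eigenvalues `(-1)^i`, `(-1)^j`. -/
noncomputable def qSpace (σ₁ σ₂ : g ≃ₗ⁅k⁆ g) (i j : Bool) : Submodule k g :=
  eigSub k g σ₁ (if i then -1 else 1) ⊓ eigSub k g σ₂ (if j then -1 else 1)

/-- `x` is a semisimple element of `g`: `ad x` is a semisimple endomorphism. -/
def IsSSElt (x : g) : Prop := Module.End.IsSemisimple (ad k g x)

/-- `x` is a nilpotent element of `g`: `ad x` is a nilpotent endomorphism. -/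
def IsNilpElt (x : g) : Prop := IsNilpotent (ad k g x)

/-- `x` is a regular element of `g`: the dimension of its centralizer equals the rank of `g`,
i.e. the dimension of a Cartan subalgebra of `g`. -/
def IsRegElt (x : g) : Prop :=
  ∃ H : LieSubalgebra k g, H.IsCartanSubalgebra ∧
    Module.finrank k (LinearMap.ker (ad k g x)) = Module.finrank k H

/-- An involution is of maximal rank if its `(-1)`-eigenspace contains a Cartan
subalgebra of `g`. -/
def IsMaxRank (σ : g ≃ₗ⁅k⁆ g) : Prop :=
  ∃ H : LieSubalgebra k g, H.IsCartanSubalgebra ∧ H.toSubmodule ≤ eigSub k g σ (-1)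

/-- The centralizer of an element `x`, as a Lie subalgebra of `g`. -/
def zg (x : g) : LieSubalgebra k g where
  carrier := {y | ⁅x, y⁆ = 0}
  add_mem' := by
    intro a b ha hb
    simp only [Set.mem_setOf_eq] at *
    rw [lie_add, ha, hb, add_zero]
  zero_mem' := by simp
  smul_mem' := by
    intro t a ha
    simp only [Set.mem_setOf_eq] at *
    rw [lie_smul, ha, smul_zero]
  lie_mem' := by
    intro a b ha hb
    simp only [Set.mem_setOf_eq] at *
    rw [leibniz_lie, ha, hb, lie_zero, zero_lie, add_zero]

/-- The fixed-point subalgebra of a Lie algebra automorphism. -/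
def fixSubalgebra (σ : g ≃ₗ⁅k⁆ g) : LieSubalgebra k g where
  carrier := {x | σ x = x}
  add_mem' := by
    intro a b ha hb
    simp only [Set.mem_setOf_eq] at *
    rw [show σ (a + b) = σ a + σ b from σ.toLieHom.map_add a b, ha, hb]
  zero_mem' := by simp only [Set.mem_setOf_eq]; exact σ.toLieHom.map_zero
  smul_mem' := by
    intro t a ha
    simp only [Set.mem_setOf_eq] at *
    rw [show σ (t • a) = t • σ a from σ.toLieHom.map_smul t a, ha]
  lie_mem' := by
    intro a b ha hb
    simp only [Set.mem_setOf_eq] at *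
    rw [LieEquiv.map_lie σ a b, ha, hb]

/-- The exponential of an endomorphism, as a finite sum (which is the genuine exponential
when the endomorphism is nilpotent). -/
noncomputable def expEnd (f : Module.End k g) : Module.End k g :=
  ∑ i ∈ Finset.range (Module.finrank k g + 1), (i.factorial : k)⁻¹ • f ^ i

/-- An automorphism of `g` is inner if it lies in the subgroup of automorphisms generated
by the exponentials `exp (ad x)` with `ad x` nilpotent. -/
noncomputable def IsInnerAut (μ : g ≃ₗ⁅k⁆ g) : Prop :=
  μ.toLinearEquiv ∈ Subgroup.closure
    {e : g ≃ₗ[k] g | ∃ x : g, IsNilpotent (ad k g x) ∧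
      (e : g →ₗ[k] g) = expEnd k g (ad k g x)}

/-- `σ` and `τ` are conjugate by an inner automorphism of `g`. -/
noncomputable def InnerConj (σ τ : g ≃ₗ⁅k⁆ g) : Prop :=
  ∃ φ : g ≃ₗ⁅k⁆ g, IsInnerAut k g φ ∧ ∀ x, τ x = φ (σ (φ.symm x))

/-- A dyad: a pair of distinct commuting involutions that are conjugate by an inner
automorphism of `g`. -/
noncomputable def IsDyad (σ₁ σ₂ : g ≃ₗ⁅k⁆ g) : Prop :=
  IsInvolution k g σ₁ ∧ IsInvolution k g σ₂ ∧ σ₁ ≠ σ₂ ∧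
    (∀ x, σ₁ (σ₂ x) = σ₂ (σ₁ x)) ∧ InnerConj k g σ₁ σ₂

/-- The span of all brackets `⁅x, y⁆` with `x, y` in a subspace `m`. -/
noncomputable def bracketSpan (m : Submodule k g) : Submodule k g :=
  Submodule.span k {z | ∃ x ∈ m, ∃ y ∈ m, z = ⁅x, y⁆}

/-- `c` is a Cartan subspace of a subspace `m ⊆ g`: it consists of pairwise commuting
semisimple elements of `g` and is maximal among such subspaces of `m`. -/
def IsCartanSubspace (m c : Submodule k g) : Prop :=
  c ≤ m ∧ (∀ x ∈ c, IsSSElt k g x) ∧ (∀ x ∈ c, ∀ y ∈ c, ⁅x, y⁆ = 0) ∧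
    ∀ c' : Submodule k g, c' ≤ m → (∀ x ∈ c', IsSSElt k g x) →
      (∀ x ∈ c', ∀ y ∈ c', ⁅x, y⁆ = 0) → c ≤ c' → c' = c

theorem mem_qSpace_iff (σ₁ σ₂ : g ≃ₗ⁅k⁆ g) (i j : Bool) (x : g) :
    x ∈ qSpace k g σ₁ σ₂ i j ↔
      σ₁ x = (if i then (-1 : k) else 1) • x ∧ σ₂ x = (if j then (-1 : k) else 1) • x := by
  unfold qSpace eigSub
  rw [Submodule.mem_inf, Module.End.mem_eigenspace_iff, Module.End.mem_eigenspace_iff]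
  rfl

theorem ad_inj_zero (x : g) (h : ad k g x = 0) : x = 0 := by
  have h1 := (LieDerivation.IsKilling.ad_apply_eq_zero_iff k g x).1
  apply h1
  ext z
  have := LinearMap.congr_fun h z
  simpa using this

theorem ad_commute (u v : g) (h : ⁅u, v⁆ = 0) : Commute (ad k g u) (ad k g v) := by
  ext z
  simp only [Module.End.mul_apply, ad_apply]
  rw [leibniz_lie, h, zero_lie, zero_add]

theorem lie_zero_of_ad_commute (u v : g) (h : Commute (ad k g u) (ad k g v)) : ⁅u, v⁆ = 0 := by
  apply ad_inj_zero k g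
  ext z
  have := LinearMap.congr_fun h.eq z
  simp only [Module.End.mul_apply, ad_apply] at this
  rw [ad_apply, lie_lie, this, sub_self, LinearMap.zero_apply]

theorem jordan_elt (y : g) : ∃ s : g, IsSSElt k g s ∧ IsNilpotent (ad k g (y - s)) ∧
    ad k g s ∈ Algebra.adjoin k {ad k g y} := by
  obtain ⟨N, -, S, hS1, hN, hS, hSN⟩ := (ad k g y).exists_isNilpotent_isSemisimple
  have hS₀ : Commute (ad k g y) S := Algebra.commute_of_mem_adjoin_self hS1
  have hN' := hN
  rw [eq_sub_of_add_eq hSN.symm] at hN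
  have aux {α : k} {z : g} (hz : z ∈ (ad k g y).maxGenEigenspace α) : S z = α • z := by
    rw [Module.End.maxGenEigenspace_eq] at hz
    rw [Module.End.apply_eq_of_mem_of_comm_of_isFinitelySemisimple_of_isNil hz hS₀
      hS.isFinitelySemisimple hN]
  have h_der (u v : g) (α β : k) (hu : u ∈ (ad k g y).maxGenEigenspace α)
      (hv : v ∈ (ad k g y).maxGenEigenspace β) :
      S ⁅u, v⁆ = ⁅S u, v⁆ + ⁅u, S v⁆ := by
    have huv : ⁅u, v⁆ ∈ (ad k g y).maxGenEigenspace (α + β) :=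
      LieModule.lie_mem_maxGenEigenspace_toEnd hu hv
    rw [aux hu, aux hv, aux huv, smul_lie, lie_smul, ← add_smul]
  replace h_der (u v : g) : S ⁅u, v⁆ = ⁅S u, v⁆ + ⁅u, S v⁆ := by
    have hu : u ∈ ⨆ α : k, (ad k g y).maxGenEigenspace α := by
      rw [Module.End.iSup_maxGenEigenspace_eq_top]; trivial
    have hv : v ∈ ⨆ α : k, (ad k g y).maxGenEigenspace α := by
      rw [Module.End.iSup_maxGenEigenspace_eq_top]; trivial
    induction hu using Submodule.iSup_induction' with
    | mem α u hu =>
      induction hv using Submodule.iSup_induction' with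
      | mem β v hv => exact h_der u v α β hu hv
      | zero => simp
      | add _ _ _ _ h h' => simp only [lie_add, map_add, h, h']; abel
    | zero => simp
    | add _ _ _ _ h h' => simp only [add_lie, map_add, h, h']; abel
  replace h_der : ∀ u v : g, S ⁅u, v⁆ = ⁅u, S v⁆ - ⁅v, S u⁆ := by
    simp_rw [← lie_skew (S _) _, add_comm, ← sub_eq_add_neg] at h_der; assumption
  let S' : LieDerivation k g g := ⟨S, h_der⟩
  obtain ⟨s, hs⟩ := LieDerivation.IsKilling.exists_eq_ad S'
  have hs' : ad k g s = S := by rw [← LieDerivation.coe_ad_apply_eq_ad_apply s, hs]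
  refine ⟨s, ?_, ?_, ?_⟩
  · unfold IsSSElt; rw [hs']; exact hS
  · rw [map_sub, hs']; exact hN
  · rw [hs']; exact hS1

theorem jordan_comm (y s z : g) (hs : ad k g s ∈ Algebra.adjoin k {ad k g y})
    (h : ⁅y, z⁆ = 0) : ⁅s, z⁆ = 0 := by
  have h1 : Commute (ad k g z) (ad k g y) := by
    apply ad_commute; rw [← lie_skew, h, neg_zero]
  have h2 : Commute (ad k g z) (ad k g s) :=
    Algebra.commute_of_mem_adjoin_singleton_of_commute hs h1
  rw [← lie_skew, lie_zero_of_ad_commute k g _ _ h2, neg_zero]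

theorem jordan_sign (σ : g ≃ₗ⁅k⁆ g) (ε : k) (y s : g) (hε : σ y = ε • y)
    (hss : IsSSElt k g s) (hn : IsNilpotent (ad k g (y - s)))
    (hs : ad k g s ∈ Algebra.adjoin k {ad k g y}) : σ s = ε • s := by
  have hc : ⁅y - s, s⁆ = 0 := by
    have := jordan_comm k g y s y hs (lie_self y)
    rw [sub_lie, lie_self, sub_zero, ← lie_skew, this, neg_zero]
  have hconj (z : g) : ad k g (σ z) = σ.toLinearEquiv.conj (ad k g z) :=
    (LieAlgebra.conj_ad_apply σ z).symm
  have hcomm (u v : g) (h : ⁅u, v⁆ = 0) : Commute (ad k g u) (ad k g v) := by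
    exact ad_commute k g u v h
  have key := Module.End.isNilpotent_isSemisimple_unique
    (n₁ := ad k g (σ (y - s))) (s₁ := ad k g (σ s))
    (n₂ := ad k g (ε • (y - s))) (s₂ := ad k g (ε • s)) ?_ ?_ ?_ ?_ ?_ ?_ ?_
  · have h2 := key.2
    rw [← sub_eq_zero, ← map_sub] at h2
    exact sub_eq_zero.1 (ad_inj_zero k g _ h2)
  · rw [hconj]
    exact hn.map (σ.toLinearEquiv.conjAlgEquiv k)
  · rw [hconj]
    refine (LinearEquiv.isSemisimple_iff _ _ σ.toLinearEquiv ?_).1 hss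
    ext z
    simp only [LinearMap.comp_apply, LinearEquiv.conj_apply, LinearEquiv.coe_coe,
      LinearEquiv.symm_apply_apply]
  · rw [map_smul]; exact hn.smul ε
  · rw [map_smul]; exact Module.End.IsSemisimple_smul ε hss
  · apply hcomm; rw [← LieEquiv.map_lie, hc]; simp
  · apply hcomm; simp [hc]
  · rw [← map_add, ← map_add, ← map_add, ← smul_add]; simp [hε]

theorem killing_self_zero (y : g) (h : IsNilpotent (ad k g y)) : killingForm k g y y = 0 := by
  rw [killingForm_apply_apply]
  apply IsNilpotent.eq_zero
  apply LinearMap.isNilpotent_trace_of_isNilpotent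
  exact (Commute.refl (ad k g y)).isNilpotent_mul_left h

/-- kernel of a generic combination -/
theorem exists_good_t (X Y : Module.End k g) (hc : Commute X Y) (hY : Y.IsSemisimple) :
    ∃ t : k, LinearMap.ker (X + t • Y) ≤ LinearMap.ker X ⊓ LinearMap.ker Y := by
  have hfX : {l : k | X.HasEigenvalue l}.Finite := Module.End.finite_hasEigenvalue X
  have hfY : {l : k | Y.HasEigenvalue l}.Finite := Module.End.finite_hasEigenvalue Y
  have hf := Set.Finite.image2 (fun l m : k => - l / m) hfX hfY
  obtain ⟨t, ht⟩ := hf.infinite_compl.nonempty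
  refine ⟨t, ?_⟩
  have hW : LinearMap.ker (X + t • Y) ≤ LinearMap.ker Y := by
    set W := LinearMap.ker (X + t • Y) with hWdef
    have hinv : ∀ v ∈ W, Y v ∈ W := by
      intro v hv
      rw [hWdef, LinearMap.mem_ker] at hv ⊢
      have h1 : Commute (X + t • Y) Y := hc.add_left ((Commute.refl Y).smul_left t)
      have := LinearMap.congr_fun h1.eq v
      simp only [Module.End.mul_apply] at this
      rw [this, hv, map_zero]
    have hr : Module.End.IsSemisimple (Y.restrict hinv) := Module.End.IsSemisimple.restrict hinv hY
    have htop := hr.iSup_eigenspace_eq_top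
    intro v hv
    have hv' : (⟨v, hv⟩ : W) ∈ ⨆ μ, Module.End.eigenspace (Y.restrict hinv) μ := by rw [htop]; trivial
    suffices (⟨v, hv⟩ : W) ∈ Module.End.eigenspace (Y.restrict hinv) 0 by
      rw [Module.End.mem_eigenspace_iff, zero_smul] at this
      exact congrArg Subtype.val this
    refine (iSup_le ?_ : ⨆ μ, Module.End.eigenspace (Y.restrict hinv) μ ≤ _) hv'
    intro μ w hw
    by_cases hμ : μ = 0
    · rwa [hμ] at hw
    by_cases hw0 : w = 0
    · rw [hw0]; exact zero_mem _
    exfalso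
    apply ht
    rw [Module.End.mem_eigenspace_iff] at hw
    have hYw : Y w.1 = μ • w.1 := congrArg Subtype.val hw
    have hXw : X w.1 = (-(t * μ)) • w.1 := by
      have : (X + t • Y) w.1 = 0 := LinearMap.mem_ker.1 w.2
      rw [LinearMap.add_apply, LinearMap.smul_apply, hYw] at this
      rw [eq_neg_of_add_eq_zero_left this, neg_smul, mul_smul]
    have hw0' : w.1 ≠ 0 := fun h => hw0 (Subtype.ext h)
    refine ⟨-(t * μ), ?_, μ, ?_, ?_⟩
    · exact Module.End.hasEigenvalue_of_hasEigenvector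
        ⟨Module.End.mem_eigenspace_iff.2 hXw, hw0'⟩
    · exact Module.End.hasEigenvalue_of_hasEigenvector
        ⟨Module.End.mem_eigenspace_iff.2 hYw, hw0'⟩
    · simp only; field_simp
  intro v hv
  have h2 := hW hv
  refine ⟨?_, h2⟩
  rw [LinearMap.mem_ker] at hv h2
  simpa [h2] using hv

theorem exists_generic (c : Submodule k g) (hss : ∀ x ∈ c, IsSSElt k g x)
    (hc : ∀ x ∈ c, ∀ y ∈ c, ⁅x, y⁆ = 0) :
    ∃ x ∈ c, ∀ z : g, ⁅x, z⁆ = 0 → ∀ y ∈ c, ⁅y, z⁆ = 0 := by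
  obtain ⟨x, hx⟩ := exists_minimalFor_of_wellFoundedLT (fun x : g => x ∈ c)
    (fun x => Module.finrank k (LinearMap.ker (ad k g x))) ⟨0, zero_mem _⟩
  refine ⟨x, hx.1, fun z hz y hy => ?_⟩
  have hcm : Commute (ad k g x) (ad k g y) := by
    exact ad_commute k g x y (hc x hx.1 y hy)
  obtain ⟨t, ht⟩ := exists_good_t k g _ _ hcm (hss y hy)
  rw [← map_smul, ← map_add] at ht
  have hmem : x + t • y ∈ c := add_mem hx.1 (c.smul_mem t hy)
  have h1 : Module.finrank k (LinearMap.ker (ad k g x)) ≤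
      Module.finrank k (LinearMap.ker (ad k g (x + t • y))) := by
    rcases le_total (Module.finrank k (LinearMap.ker (ad k g x)))
      (Module.finrank k (LinearMap.ker (ad k g (x + t • y)))) with h | h
    · exact h
    · exact hx.2 hmem h
  have h2 := Submodule.finrank_mono (R := k) ht
  have h3 := Submodule.eq_of_le_of_finrank_le
    (inf_le_left : LinearMap.ker (ad k g x) ⊓ LinearMap.ker (ad k g y) ≤ _) (h1.trans h2)
  have hz' : z ∈ LinearMap.ker (ad k g x) := by rw [LinearMap.mem_ker, ad_apply, hz]
  rw [← h3] at hz'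
  simpa using hz'.2

theorem exists_cartan (m : Submodule k g) : ∃ c, IsCartanSubspace k g m c := by
  obtain ⟨c, hc⟩ := exists_maximal_of_wellFoundedGT (fun c : Submodule k g => c ≤ m ∧
    (∀ x ∈ c, IsSSElt k g x) ∧ (∀ x ∈ c, ∀ y ∈ c, ⁅x, y⁆ = 0)) ⟨⊥, bot_le, by
      intro x hx; rw [(Submodule.mem_bot k).1 hx]; unfold IsSSElt; rw [map_zero]
      exact Module.End.isSemisimple_zero, by
      intro x hx y hy; rw [(Submodule.mem_bot k).1 hx, zero_lie]⟩
  exact ⟨c, hc.1.1, hc.1.2.1, hc.1.2.2, fun c' h1 h2 h3 h4 =>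
    le_antisymm (hc.2 ⟨h1, h2, h3⟩ h4) h4⟩

theorem ker_sup_range (x : g) (h : IsSSElt k g x) (w : g) :
    ∃ w' w'' : g, ⁅x, w'⁆ = 0 ∧ w = w' + ⁅x, w''⁆ := by
  have htop := Module.End.IsSemisimple.iSup_eigenspace_eq_top h
  have hw : w ∈ ⨆ μ, (ad k g x).eigenspace μ := by rw [htop]; trivial
  induction hw using Submodule.iSup_induction' with
  | mem μ v hv =>
    rw [Module.End.mem_eigenspace_iff, ad_apply] at hv
    by_cases hμ : μ = 0
    · exact ⟨v, 0, by rw [hv, hμ, zero_smul], by simp⟩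
    · exact ⟨0, μ⁻¹ • v, by simp, by rw [lie_smul, hv, smul_smul, inv_mul_cancel₀ hμ]; simp⟩
  | zero => exact ⟨0, 0, by simp, by simp⟩
  | add u v _ _ hu hv =>
    obtain ⟨a, b, h1, h2⟩ := hu
    obtain ⟨a', b', h1', h2'⟩ := hv
    exact ⟨a + a', b + b', by rw [lie_add, h1, h1', add_zero], by rw [lie_add, h2, h2']; abel⟩

theorem sgn_sq (i : Bool) : (if i then (-1 : k) else 1) * (if i then (-1 : k) else 1) = 1 := by
  cases i <;> simp

theorem killing_move (σ : g ≃ₗ⁅k⁆ g) (hi : IsInvolution k g σ) (i : Bool) (y w : g)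
    (hy : σ y = (if i then (-1 : k) else 1) • y) :
    killingForm k g y (w + (if i then (-1 : k) else 1) • σ w) = 2 * killingForm k g y w := by
  have h1 : killingForm k g (σ y) (σ w) = killingForm k g y w :=
    LieAlgebra.killingForm_of_equiv_apply σ y w
  rw [hy, map_smul, LinearMap.smul_apply] at h1
  rw [map_add, map_smul, h1]; ring

theorem lie_move (σ : g ≃ₗ⁅k⁆ g) (e ε : k) (x w : g) (he : e * e = 1)
    (hx : σ x = e • x) (h : ⁅x, w⁆ = 0) : ⁅x, w + ε • σ w⁆ = 0 := by
  have h1 : ⁅σ x, σ w⁆ = 0 := by rw [← LieEquiv.map_lie, h]; simp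
  rw [hx, smul_lie] at h1
  have h2 : ⁅x, σ w⁆ = 0 := by
    rw [← one_smul k ⁅x, σ w⁆, ← he, mul_smul, h1, smul_zero]
  rw [lie_add, lie_smul, h, h2]; simp

theorem no_centralizer (σ₁ σ₂ : g ≃ₗ⁅k⁆ g) (hcomm : CommutingInvolutions k g σ₁ σ₂)
    (a c : Bool × Bool) (x : g) (hx : x ∈ qSpace k g σ₁ σ₂ a.1 a.2) (hxs : IsSSElt k g x)
    (hnil : ∀ y ∈ qSpace k g σ₁ σ₂ c.1 c.2, ⁅x, y⁆ = 0 → IsNilpotent (ad k g y))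
    (y : g) (hy : y ∈ qSpace k g σ₁ σ₂ c.1 c.2) (hxy : ⁅x, y⁆ = 0) : y = 0 := by
  obtain ⟨hi1, hi2, hc⟩ := hcomm
  -- the form vanishes on the centralizer
  have hform : ∀ z ∈ qSpace k g σ₁ σ₂ c.1 c.2, ⁅x, z⁆ = 0 → killingForm k g y z = 0 := by
    intro z hz hxz
    have h1 := killing_self_zero k g y (hnil y hy hxy)
    have h2 := killing_self_zero k g z (hnil z hz hxz)
    have h3 := killing_self_zero k g (y + z)
      (hnil _ (add_mem hy hz) (by rw [lie_add, hxy, hxz, add_zero]))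
    have h4 : killingForm k g z y = killingForm k g y z := LieModule.traceForm_comm k g g z y
    simp only [map_add, LinearMap.add_apply, h1, h2, h4, zero_add, add_zero] at h3
    have : (2 : k) * killingForm k g y z = 0 := by rw [two_mul]; exact h3
    simpa using this
  have hall : killingForm k g y = 0 := by
    ext w
    obtain ⟨w', w'', hw', rfl⟩ := ker_sup_range k g x hxs w
    have hbr : killingForm k g y ⁅x, w''⁆ = 0 := by
      have := LieModule.traceForm_apply_lie_apply k g g y x w''
      have hyx : ⁅y, x⁆ = 0 := by rw [← lie_skew, hxy, neg_zero]
      rw [hyx] at this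
      rw [map_zero, LinearMap.zero_apply] at this
      exact this.symm
    rw [map_add, hbr, add_zero, LinearMap.zero_apply]
    rw [mem_qSpace_iff] at hx hy
    set e1 := (if c.1 then (-1 : k) else 1) with he1
    set e2 := (if c.2 then (-1 : k) else 1) with he2
    have hu := lie_move k g σ₁ _ e1 x w' (sgn_sq k a.1) hx.1 hw'
    have hv := lie_move k g σ₂ _ e2 x _ (sgn_sq k a.2) hx.2 hu
    have ku := killing_move k g σ₁ hi1 c.1 y w' hy.1
    have kv := killing_move k g σ₂ hi2 c.2 y (w' + e1 • σ₁ w') hy.2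
    rw [← he1] at ku
    rw [← he2] at kv
    have s1 : e1 * e1 = 1 := sgn_sq k c.1
    have s2 : e2 * e2 = 1 := sgn_sq k c.2
    rw [hform _ _ hv, ku] at kv
    · have : (2 : k) * (2 * killingForm k g y w') = 0 := kv.symm
      simpa using this
    · rw [mem_qSpace_iff, ← he1, ← he2]
      have hi1' := hi1 w'
      have hi2' := hi2 w'
      have hi3 := hi2 (σ₁ w')
      have hi4 := hi1 (σ₂ w')
      have hc' := hc w'
      simp only [map_add, map_smul, hi1', hi2', hi3, hc, smul_add, smul_smul]
      constructor
      · rw [s1, mul_comm e1 (e2 * e1), mul_assoc, s1, mul_one, one_smul,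
          mul_comm e2 e1]
        abel
      · rw [← mul_assoc, s2, one_mul, one_smul]
        abel
  have := LieAlgebra.IsKilling.ker_killingForm_eq_bot k g
  have hm : y ∈ LinearMap.ker (killingForm k g) := LinearMap.mem_ker.2 hall
  rw [this] at hm
  simpa using hm

theorem qSpace_disjoint (σ₁ σ₂ : g ≃ₗ⁅k⁆ g) (a c : Bool × Bool) (hac : a ≠ c) (s : g)
    (h1 : s ∈ qSpace k g σ₁ σ₂ a.1 a.2) (h2 : s ∈ qSpace k g σ₁ σ₂ c.1 c.2) : s = 0 := by
  rw [mem_qSpace_iff] at h1 h2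
  have aux : ∀ i j : Bool, i ≠ j →
      (if i then (-1 : k) else 1) • s = (if j then (-1 : k) else 1) • s → s = 0 := by
    intro i j hij h
    rw [← sub_eq_zero, ← sub_smul, smul_eq_zero] at h
    refine h.resolve_left ?_
    revert hij
    cases i <;> cases j <;> norm_num
  by_cases h : a.1 = c.1
  · exact aux a.2 c.2 (fun h' => hac (Prod.ext h h')) (h1.2.symm.trans h2.2)
  · exact aux a.1 c.1 h (h1.1.symm.trans h2.1)

theorem lie_mem_qSpace (σ₁ σ₂ : g ≃ₗ⁅k⁆ g) (a b c : Bool × Bool)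
    (ha : a ≠ (false, false)) (hb : b ≠ (false, false)) (hc : c ≠ (false, false))
    (hab : a ≠ b) (hac : a ≠ c) (hbc : b ≠ c) (x y : g)
    (h1 : x ∈ qSpace k g σ₁ σ₂ a.1 a.2) (h2 : y ∈ qSpace k g σ₁ σ₂ c.1 c.2) :
    ⁅x, y⁆ ∈ qSpace k g σ₁ σ₂ b.1 b.2 := by
  rw [mem_qSpace_iff] at h1 h2 ⊢
  rw [LieEquiv.map_lie, LieEquiv.map_lie, h1.1, h1.2, h2.1, h2.2]
  obtain ⟨a1, a2⟩ := a
  obtain ⟨b1, b2⟩ := b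
  obtain ⟨c1, c2⟩ := c
  cases a1 <;> cases a2 <;> cases b1 <;> cases b2 <;> cases c1 <;> cases c2 <;> simp_all

/-- For any permutation `(α, β, γ)` of the indices `(01, 10, 11)`,
if every Cartan subspace of `g_α` is also a Cartan subspace of `g_α ⊕ g_γ`, then
`dim g_β ≥ dim g_γ`. -/
theorem dim_ge_of_cartanSubspace_coincidence (σ₁ σ₂ : g ≃ₗ⁅k⁆ g)
    (hcomm : CommutingInvolutions k g σ₁ σ₂) :
    ∀ a b c : Bool × Bool,
      a ≠ (false, false) → b ≠ (false, false) → c ≠ (false, false) →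
      a ≠ b → a ≠ c → b ≠ c →
      (∀ cs : Submodule k g, IsCartanSubspace k g (qSpace k g σ₁ σ₂ a.1 a.2) cs →
        IsCartanSubspace k g
          (qSpace k g σ₁ σ₂ a.1 a.2 ⊔ qSpace k g σ₁ σ₂ c.1 c.2) cs) →
      Module.finrank k (qSpace k g σ₁ σ₂ c.1 c.2) ≤
        Module.finrank k (qSpace k g σ₁ σ₂ b.1 b.2) := by
  intro a b c ha hb hc hab hac hbc hcs
  obtain ⟨cs, hC⟩ := exists_cartan k g (qSpace k g σ₁ σ₂ a.1 a.2)
  obtain ⟨x, hxc, hgen⟩ := exists_generic k g cs hC.2.1 hC.2.2.1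
  have hD := hcs cs hC
  have hxa := hC.1 hxc
  have hnil : ∀ y ∈ qSpace k g σ₁ σ₂ c.1 c.2, ⁅x, y⁆ = 0 → IsNilpotent (ad k g y) := by
    intro y hy hxy
    obtain ⟨s, hs, hn, hadj⟩ := jordan_elt k g y
    have hsc : ∀ z ∈ cs, ⁅s, z⁆ = 0 := fun z hz =>
      jordan_comm k g y s z hadj (by rw [← lie_skew, hgen y hxy z hz, neg_zero])
    have hsq : s ∈ qSpace k g σ₁ σ₂ c.1 c.2 := by
      rw [mem_qSpace_iff] at hy ⊢
      exact ⟨jordan_sign k g σ₁ _ y s hy.1 hs hn hadj, jordan_sign k g σ₂ _ y s hy.2 hs hn hadj⟩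
    have heq := hD.2.2.2 (cs ⊔ Submodule.span k {s})
      (sup_le hD.1 ((Submodule.span_singleton_le_iff_mem _ _).2 (Submodule.mem_sup_right hsq)))
      (by
        intro z hz
        obtain ⟨u, hu, v, hv, rfl⟩ := Submodule.mem_sup.1 hz
        obtain ⟨t, rfl⟩ := Submodule.mem_span_singleton.1 hv
        unfold IsSSElt
        rw [map_add, map_smul]
        refine Module.End.IsSemisimple.add_of_commute ?_ (hD.2.1 u hu)
          (Module.End.IsSemisimple_smul t hs)
        refine Commute.smul_right ?_ t
        apply ad_commute; rw [← lie_skew, hsc u hu, neg_zero])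
      (by
        intro z hz z' hz'
        obtain ⟨u, hu, v, hv, rfl⟩ := Submodule.mem_sup.1 hz
        obtain ⟨t, rfl⟩ := Submodule.mem_span_singleton.1 hv
        obtain ⟨u', hu', v', hv', rfl⟩ := Submodule.mem_sup.1 hz'
        obtain ⟨t', rfl⟩ := Submodule.mem_span_singleton.1 hv'
        have h1 : ⁅u, s⁆ = 0 := by rw [← lie_skew, hsc u hu, neg_zero]
        simp [hD.2.2.1 u hu u' hu', h1, hsc u' hu'])
      le_sup_left
    have hscs : s ∈ cs := by
      rw [← heq]; exact Submodule.mem_sup_right (Submodule.mem_span_singleton_self s)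
    have hs0 := qSpace_disjoint k g σ₁ σ₂ a c hac s (hC.1 hscs) hsq
    rwa [hs0, sub_zero] at hn
  have hno := no_centralizer k g σ₁ σ₂ hcomm a c x hxa (hC.2.1 x hxc) hnil
  let f : qSpace k g σ₁ σ₂ c.1 c.2 →ₗ[k] qSpace k g σ₁ σ₂ b.1 b.2 :=
    (ad k g x).restrict (fun y hy =>
      lie_mem_qSpace k g σ₁ σ₂ a b c ha hb hc hab hac hbc x y hxa hy)
  apply LinearMap.finrank_le_finrank_of_injective (f := f)
  rw [← LinearMap.ker_eq_bot, Submodule.eq_bot_iff]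
  intro y hy
  exact Subtype.ext (hno y.1 y.2 (congrArg Subtype.val (LinearMap.mem_ker.1 hy)))
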